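/- arXiv:math/0410314 — 2 statements merged into one kernel-verified Lean document; each statement's English description precedes it below -/
import Mathlib

section
/- For all reals x > 0 and y > 0 there exist real numbers a ∈ (0,x) and b ∈ (0,y) satisfying 2ya/√(a² + 1/4) + a/√(a² + (y−b)²) + (a−x)/√(b² + (x−a)²) = 0 and 2xb/√(b² + 1/4) + b/√(b² + (x−a)²) + (b−y)/√(a² + (y−b)²) = 0. (For every x, y > 0 the minimality equations of the discrete Schwarz CLP surface have a solution.) -/
open Set

/-- If `f` attains its minimum over `[l, u]` at `c`, its derivative at `c` is nonnegative in
every direction pointing into the interval. -/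
theorem IsMinOn.hasDerivAt_mul_sub_nonneg {f : ℝ → ℝ} {d l u c z : ℝ}
    (h : IsMinOn f (Icc l u) c) (hf : HasDerivAt f d c) (hc : c ∈ Icc l u)
    (hz : z ∈ Icc l u) : 0 ≤ (z - c) * d := by
  have := h.localize.hasFDerivWithinAt_nonneg hf.hasFDerivAt.hasFDerivWithinAt
    (sub_mem_posTangentConeAt_of_segment_subset ((convex_Icc l u).segment_subset hc hz))
  simpa using this

theorem hasDerivAt_sqrt_sq_add {a c : ℝ} (h : 0 < a ^ 2 + c) :
    HasDerivAt (fun t : ℝ => √(t ^ 2 + c)) (a / √(a ^ 2 + c)) a := by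
  refine (((hasDerivAt_pow 2 a).add_const c).sqrt h.ne').congr_deriv ?_
  have := (Real.sqrt_pos.2 h).ne'
  simp
  field_simp

/-- The area of the fundamental piece of the discrete Schwarz CLP surface, up to a factor, as a
function of the position `(a, b)` of its interior vertex. -/
noncomputable def schwarzCLPArea (x y a b : ℝ) : ℝ :=
  2 * y * √(a ^ 2 + 1 / 4) + 2 * x * √(b ^ 2 + 1 / 4)
    + √(a ^ 2 + (y - b) ^ 2) + √(b ^ 2 + (x - a) ^ 2)

theorem schwarzCLPArea_swap (x y a b : ℝ) :
    schwarzCLPArea y x b a = schwarzCLPArea x y a b := by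
  simp only [schwarzCLPArea]
  ring

theorem continuous_schwarzCLPArea (x y : ℝ) :
    Continuous fun p : ℝ × ℝ => schwarzCLPArea x y p.1 p.2 := by
  unfold schwarzCLPArea
  fun_prop

theorem hasDerivAt_schwarzCLPArea {x y a b : ℝ} (h₁ : 0 < a ^ 2 + (y - b) ^ 2)
    (h₂ : 0 < b ^ 2 + (x - a) ^ 2) :
    HasDerivAt (fun t => schwarzCLPArea x y t b)
      (2 * y * a / √(a ^ 2 + 1 / 4) + a / √(a ^ 2 + (y - b) ^ 2)
        + (a - x) / √(b ^ 2 + (x - a) ^ 2)) a := by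
  have e : ∀ t : ℝ, b ^ 2 + (x - t) ^ 2 = (t - x) ^ 2 + b ^ 2 := fun t => by ring
  simp only [schwarzCLPArea, e] at h₂ ⊢
  refine (((((hasDerivAt_sqrt_sq_add (a := a) (c := 1 / 4) (by positivity)).const_mul
    (2 * y)).add_const (2 * x * √(b ^ 2 + 1 / 4))).add (hasDerivAt_sqrt_sq_add h₁)).add
    ((hasDerivAt_sqrt_sq_add h₂).comp_sub_const a x)).congr_deriv ?_
  ring

/-- The area is not minimal at the corner `(0, y)`: it decreases along the diagonal to `(x, 0)`,
on which the last two terms of the area have constant sum. -/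
theorem not_isMinOn_schwarzCLPArea_corner {x y : ℝ} (hx : 0 < x) (hy : 0 < y) :
    ¬ IsMinOn (fun p : ℝ × ℝ => schwarzCLPArea x y p.1 p.2) (Icc 0 x ×ˢ Icc 0 y) (0, y) := by
  intro h
  let g : ℝ → ℝ := fun t =>
    2 * y * √((t * x) ^ 2 + 1 / 4) + 2 * x * √((y - t * y) ^ 2 + 1 / 4) + √(x ^ 2 + y ^ 2)
  have hg : ∀ t ∈ Icc (0 : ℝ) 1, schwarzCLPArea x y (t * x) (y - t * y) = g t := by
    intro t ht
    have e₁ : (t * x) ^ 2 + (y - (y - t * y)) ^ 2 = t ^ 2 * (x ^ 2 + y ^ 2) := by ring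
    have e₂ : (y - t * y) ^ 2 + (x - t * x) ^ 2 = (1 - t) ^ 2 * (x ^ 2 + y ^ 2) := by ring
    simp only [schwarzCLPArea, g]
    rw [e₁, e₂, Real.sqrt_mul (sq_nonneg _), Real.sqrt_mul (sq_nonneg _), Real.sqrt_sq ht.1,
      Real.sqrt_sq (sub_nonneg.2 ht.2)]
    ring
  have hmin : IsMinOn g (Icc 0 1) 0 := by
    intro t ht
    have hmem : (t * x, y - t * y) ∈ Icc 0 x ×ˢ Icc 0 y := by
      obtain ⟨h0, h1⟩ := ht
      refine ⟨⟨by positivity, ?_⟩, ?_, ?_⟩ <;> dsimp only <;> nlinarith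
    have := h hmem
    simpa [← hg t ht, ← hg 0 (by simp)] using this
  have hd : HasDerivAt g (-(2 * x * y ^ 2 / √(y ^ 2 + 1 / 4))) 0 := by
    have d₁ : HasDerivAt (fun t : ℝ => t * x) x 0 := by
      simpa using (hasDerivAt_id (0 : ℝ)).mul_const x
    have d₂ : HasDerivAt (fun t : ℝ => y - t * y) (-y) 0 := by
      simpa using ((hasDerivAt_id (0 : ℝ)).mul_const y).const_sub y
    have s₁ := (hasDerivAt_sqrt_sq_add (a := 0 * x) (c := 1 / 4) (by positivity)).comp 0 d₁
    have s₂ := (hasDerivAt_sqrt_sq_add (a := y - 0 * y) (c := 1 / 4) (by positivity)).comp 0 d₂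
    refine (((s₁.const_mul (2 * y)).add (s₂.const_mul (2 * x))).add_const
      (√(x ^ 2 + y ^ 2))).congr_deriv ?_
    simp
    ring
  have := hmin.hasDerivAt_mul_sub_nonneg hd (by simp) (right_mem_Icc.2 zero_le_one)
  have : 0 < 2 * x * y ^ 2 / √(y ^ 2 + 1 / 4) := by positivity
  linarith

theorem isMinOn_schwarzCLPArea_swap {x y a b : ℝ}
    (h : IsMinOn (fun p : ℝ × ℝ => schwarzCLPArea x y p.1 p.2) (Icc 0 x ×ˢ Icc 0 y) (a, b)) :
    IsMinOn (fun p : ℝ × ℝ => schwarzCLPArea y x p.1 p.2) (Icc 0 y ×ˢ Icc 0 x) (b, a) := by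
  intro p hp
  have := h (show (p.2, p.1) ∈ Icc 0 x ×ˢ Icc 0 y from ⟨hp.2, hp.1⟩)
  simpa [schwarzCLPArea_swap x y] using this

theorem IsMinOn.schwarzCLPArea_fst {x y a b : ℝ} (hb : b ∈ Icc 0 y)
    (h : IsMinOn (fun p : ℝ × ℝ => schwarzCLPArea x y p.1 p.2) (Icc 0 x ×ˢ Icc 0 y) (a, b)) :
    IsMinOn (fun t => schwarzCLPArea x y t b) (Icc 0 x) a :=
  fun t ht => h (show (t, b) ∈ Icc 0 x ×ˢ Icc 0 y from ⟨ht, hb⟩)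

theorem mem_Ioo_of_isMinOn_schwarzCLPArea {x y a b : ℝ} (hx : 0 < x) (hy : 0 < y)
    (ha : a ∈ Icc 0 x) (hb : b ∈ Icc 0 y)
    (h : IsMinOn (fun p : ℝ × ℝ => schwarzCLPArea x y p.1 p.2) (Icc 0 x ×ˢ Icc 0 y) (a, b)) :
    a ∈ Ioo 0 x := by
  have hfst := h.schwarzCLPArea_fst hb
  refine ⟨ha.1.lt_of_ne' ?_, ha.2.lt_of_ne ?_⟩
  · rintro rfl
    rcases hb.2.eq_or_lt with rfl | hby
    · exact not_isMinOn_schwarzCLPArea_corner hx hy h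
    have := sub_pos.2 hby
    have := hfst.hasDerivAt_mul_sub_nonneg
      (hasDerivAt_schwarzCLPArea (by positivity) (by simp; positivity)) ha ⟨hx.le, le_rfl⟩
    have hpos : 0 < x * (x / √(b ^ 2 + x ^ 2)) := by positivity
    simp [neg_div] at this
    linarith
  · rintro rfl
    rcases hb.1.eq_or_lt with rfl | hb0
    · exact not_isMinOn_schwarzCLPArea_corner hy hx (isMinOn_schwarzCLPArea_swap h)
    have := hfst.hasDerivAt_mul_sub_nonneg
      (hasDerivAt_schwarzCLPArea (by positivity) (by positivity)) ha ⟨le_rfl, hx.le⟩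
    have hpos : 0 < a * (2 * y * a / √(a ^ 2 + 1 / 4) + a / √(a ^ 2 + (y - b) ^ 2)) := by
      positivity
    simp only [sub_self, zero_div, add_zero, zero_sub, neg_mul] at this
    linarith

theorem IsMinOn.schwarzCLPArea_partial_eq_zero {x y a b : ℝ} (ha : a ∈ Ioo 0 x)
    (hb : b ∈ Ioo 0 y)
    (h : IsMinOn (fun p : ℝ × ℝ => schwarzCLPArea x y p.1 p.2) (Icc 0 x ×ˢ Icc 0 y) (a, b)) :
    2 * y * a / √(a ^ 2 + 1 / 4) + a / √(a ^ 2 + (y - b) ^ 2)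
      + (a - x) / √(b ^ 2 + (x - a) ^ 2) = 0 := by
  have ha0 := ha.1
  have hb0 := hb.1
  exact ((h.schwarzCLPArea_fst (Ioo_subset_Icc_self hb)).isLocalMin
    (Icc_mem_nhds ha.1 ha.2)).hasDerivAt_eq_zero
    (hasDerivAt_schwarzCLPArea (by positivity) (by positivity))

/-- For every x, y > 0 the minimality equations of the discrete Schwarz CLP
surface have a solution with a ∈ (0, x) and b ∈ (0, y). -/
theorem schwarzCLP_solution_exists (x y : ℝ) (hx : 0 < x) (hy : 0 < y) :
    ∃ a ∈ Set.Ioo (0 : ℝ) x, ∃ b ∈ Set.Ioo (0 : ℝ) y,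
      2 * y * a / Real.sqrt (a ^ 2 + 1 / 4) + a / Real.sqrt (a ^ 2 + (y - b) ^ 2)
          + (a - x) / Real.sqrt (b ^ 2 + (x - a) ^ 2) = 0 ∧
      2 * x * b / Real.sqrt (b ^ 2 + 1 / 4) + b / Real.sqrt (b ^ 2 + (x - a) ^ 2)
          + (b - y) / Real.sqrt (a ^ 2 + (y - b) ^ 2) = 0 := by
  obtain ⟨⟨a, b⟩, ⟨ha, hb⟩, hmin⟩ := (isCompact_Icc.prod isCompact_Icc).exists_isMinOn
    (⟨(0, 0), ⟨le_rfl, hx.le⟩, le_rfl, hy.le⟩ : (Icc 0 x ×ˢ Icc 0 y).Nonempty)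
    (continuous_schwarzCLPArea x y).continuousOn
  have hmin' := isMinOn_schwarzCLPArea_swap hmin
  have ha' := mem_Ioo_of_isMinOn_schwarzCLPArea hx hy ha hb hmin
  have hb' := mem_Ioo_of_isMinOn_schwarzCLPArea hy hx hb ha hmin'
  exact ⟨a, ha', b, hb', hmin.schwarzCLPArea_partial_eq_zero ha' hb',
    hmin'.schwarzCLPArea_partial_eq_zero hb' ha'⟩
end

section
/- There exist real numbers a, b with 0 < a < 1 and 0 < b < 1 satisfying both 1 + a + a² − 3b − 2ab + 2b² = 0 and a² + a(2 − 3b) + b(3b − 3 + √((1 + a − b)² + 2(1 − b)²)) = 0. (Existence of parameters making the discrete I-Wp surface minimal.) -/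
/-- Existence of parameters a, b ∈ (0, 1) making the discrete I-Wp surface
minimal: both minimality equations are satisfied. -/
theorem iwp_solution_exists :
    ∃ a b : ℝ, 0 < a ∧ a < 1 ∧ 0 < b ∧ b < 1 ∧
      1 + a + a ^ 2 - 3 * b - 2 * a * b + 2 * b ^ 2 = 0 ∧
      a ^ 2 + a * (2 - 3 * b)
          + b * (3 * b - 3 + Real.sqrt ((1 + a - b) ^ 2 + 2 * (1 - b) ^ 2)) = 0 := by
  -- Solve the quadratic equation for `a`, then vary `b` in `[13/25, 3/5]`.
  let A : ℝ → ℝ := fun b => (2 * b - 1 + Real.sqrt (-3 + 8 * b - 4 * b ^ 2)) / 2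
  let F : ℝ → ℝ := fun b => A b ^ 2 + A b * (2 - 3 * b)
    + b * (3 * b - 3 + Real.sqrt ((1 + A b - b) ^ 2 + 2 * (1 - b) ^ 2))
  have hF : Continuous F := by fun_prop
  have hA₁ : A (13 / 25) = 4 / 25 := by
    have h : Real.sqrt (-3 + 8 * (13 / 25) - 4 * (13 / 25) ^ 2) = 7 / 25 := by
      rw [Real.sqrt_eq_iff_mul_self_eq] <;> norm_num
    simp only [A, h]
    norm_num
  have hA₂ : A (3 / 5) = 2 / 5 := by
    have h : Real.sqrt (-3 + 8 * (3 / 5) - 4 * (3 / 5) ^ 2) = 3 / 5 := by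
      rw [Real.sqrt_eq_iff_mul_self_eq] <;> norm_num
    simp only [A, h]
    norm_num
  have hF₁ : F (13 / 25) ≤ 0 := by
    have h : Real.sqrt ((1 + 4 / 25 - 13 / 25) ^ 2 + 2 * (1 - 13 / 25) ^ 2) ≤ 1 :=
      Real.sqrt_le_one.mpr (by norm_num)
    simp only [F, hA₁]
    linarith
  have hF₂ : 0 ≤ F (3 / 5) := by
    have h : 4 / 5 ≤ Real.sqrt ((1 + 2 / 5 - 3 / 5) ^ 2 + 2 * (1 - 3 / 5) ^ 2) :=
      Real.le_sqrt_of_sq_le (by norm_num)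
    simp only [F, hA₂]
    linarith
  obtain ⟨b, ⟨hb₁, hb₂⟩, hb⟩ :=
    intermediate_value_Icc (by norm_num : (13 / 25 : ℝ) ≤ 3 / 5) hF.continuousOn ⟨hF₁, hF₂⟩
  have hs : 0 ≤ Real.sqrt (-3 + 8 * b - 4 * b ^ 2) := Real.sqrt_nonneg _
  have hsq : Real.sqrt (-3 + 8 * b - 4 * b ^ 2) ^ 2 = -3 + 8 * b - 4 * b ^ 2 :=
    Real.sq_sqrt (by nlinarith)
  have hlt : Real.sqrt (-3 + 8 * b - 4 * b ^ 2) < 3 - 2 * b :=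
    (Real.sqrt_lt' (by linarith)).mpr (by nlinarith)
  refine ⟨A b, b, ?_, ?_, by linarith, by linarith, ?_, hb⟩
  · simp only [A]
    linarith
  · simp only [A]
    linarith
  · simp only [A]
    linear_combination hsq / 4
end
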